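/- Fix a tuple n ∈ {1,…,ℓ}^{r+1}, an integer q, and an integer p with p ≥ i^0_ℓ + ⋯ + i^s_ℓ − a_1·j^1_1 − ⋯ − a_r·j^r_1 − 1. If m = (m_0,…,m_s) ∈ {1,…,ℓ}^{s+1} satisfies m_t < ℓ for every t = 0,…,s, then Ψ_m(p;c) = ∅ for every c ∈ Ψ_n(q). -/

import Mathlib

/-- A sequence that is nondecreasing on `{1, …, ℓ}` in the successor sense is monotone there. -/
theorem le_of_le_succ_on_Icc {ℓ : ℕ} {f : ℕ → ℤ}
    (hf : ∀ x, 1 ≤ x → x < ℓ → f x ≤ f (x + 1)) {x y : ℕ} (hx : 1 ≤ x) (hxy : x ≤ y)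
    (hy : y ≤ ℓ) : f x ≤ f y := by
  induction y, hxy using Nat.le_induction with
  | base => exact le_rfl
  | succ k hk ih => exact (ih (by omega)).trans (hf k (by omega) (by omega))


/-- Fix a tuple `n`, an integer `q`, and `p ≥ i^0_ℓ + ⋯ + i^s_ℓ − a_1 j^1_1 − ⋯
− a_r j^r_1 − 1`. If `m = (m_0,…,m_s)` satisfies `m_t < ℓ` for all `t`, then `Ψ_m(p;c) = ∅`
for every `c ∈ Ψ_n(q)`. -/
theorem stmt_5 (s r ℓ : ℕ) (hs : 1 ≤ s) (hr : 1 ≤ r) (hl : 1 ≤ ℓ)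
    (a : Fin r → ℤ) (ha0 : 0 ≤ a ⟨0, by omega⟩) (hamono : Monotone a)
    (i : Fin (s + 1) → ℕ → ℤ) (hi : ∀ t x, 1 ≤ x → x < ℓ → i t x ≤ i t (x + 1))
    (j : Fin (r + 1) → ℕ → ℤ) (hj : ∀ u x, 1 ≤ x → x < ℓ → j u x ≤ j u (x + 1))
    (n : Fin (r + 1) → ℕ) (hn : ∀ u, 1 ≤ n u ∧ n u ≤ ℓ)
    (q : ℤ) (p : ℤ)
    (hp : (∑ t : Fin (s + 1), i t ℓ) - (∑ u : Fin r, a u * j u.succ 1) - 1 ≤ p)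
    (m : Fin (s + 1) → ℕ) (hm : ∀ t, 1 ≤ m t ∧ m t ≤ ℓ) (hmlt : ∀ t, m t < ℓ) :
    ∀ c : Fin r → ℤ,
      c ∈ {c : Fin r → ℤ |
        (∑ u, c u) ≤ q - j 0 (n 0) ∧
        (n 0 < ℓ → q - j 0 (n 0 + 1) < ∑ u, c u) ∧
        ∀ u : Fin r, j u.succ (n u.succ) ≤ c u ∧
          (n u.succ < ℓ → c u < j u.succ (n u.succ + 1))} →
      {d : Fin s → ℤ |
        (∑ t, d t) ≤ p + (∑ u, a u * c u) - i 0 (m 0) ∧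
        (m 0 < ℓ → p + (∑ u, a u * c u) - i 0 (m 0 + 1) < ∑ t, d t) ∧
        ∀ t : Fin s, i t.succ (m t.succ) ≤ d t ∧
          (m t.succ < ℓ → d t < i t.succ (m t.succ + 1))} = ∅ := by
  intro c ⟨_, _, hc⟩
  refine Set.eq_empty_iff_forall_notMem.mpr ?_
  rintro d ⟨_, hd0, hd⟩
  have ha : ∀ u, 0 ≤ a u := fun u => ha0.trans (hamono (Nat.zero_le u.val))
  have hA : ∑ u : Fin r, a u * j u.succ 1 ≤ ∑ u, a u * c u :=
    Finset.sum_le_sum fun u _ => mul_le_mul_of_nonneg_left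
      ((le_of_le_succ_on_Icc (hj u.succ) le_rfl (hn u.succ).1 (hn u.succ).2).trans (hc u).1)
      (ha u)
  have hi_top : ∀ t, i t (m t + 1) ≤ i t ℓ := fun t =>
    le_of_le_succ_on_Icc (hi t) (Nat.le_add_left 1 (m t)) (hmlt t) le_rfl
  have hD : ∑ t, d t ≤ ∑ t : Fin s, (i t.succ ℓ - 1) := Finset.sum_le_sum fun t _ => by
    have := (hd t).2 (hmlt t.succ)
    have := hi_top t.succ
    omega
  simp only [Finset.sum_sub_distrib, Finset.sum_const, Finset.card_univ, Fintype.card_fin,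
    nsmul_eq_mul, mul_one] at hD
  rw [Fin.sum_univ_succ] at hp
  have := hd0 (hmlt 0)
  have := hi_top 0
  omega
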